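/- Proposition 3.6 (walks in the index diagram give addresses): Let K be the attractor of a system of injective contractions S_i (i ∈ I) on a complete metric space, with critical set C and self-similar boundary ∂K. Let p ∈ ∂K and let ι : ℕ → I. Then ι is an address of p if and only if there exists a sequence q : ℕ → X with q(n) ∈ ∂K for all n, q(0) = p, and S_{ι(n)}(q(n+1)) = q(n) for all n. (In particular, the set of addresses of p is exactly the set of label sequences of infinite walks from p in the index diagram.) -/

import Mathlib

/-- `SWord S w` is the composition `S_{i₁} ∘ ⋯ ∘ S_{iₙ}` for the word `w = i₁…iₙ`
(the identity for the empty word). -/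
def SWord {X : Type*} {m : ℕ} (S : Fin m → X → X) : List (Fin m) → X → X
  | [] => id
  | i :: w => S i ∘ SWord S w

/-- `α : ℕ → Fin m` is an address of `x` if `x ∈ K_{α|n} = S_{α(0)…α(n-1)}(K)`
for every `n ≥ 1`. -/
def IsAddress {X : Type*} {m : ℕ} (S : Fin m → X → X) (K : Set X) (x : X)
    (α : ℕ → Fin m) : Prop :=
  ∀ n : ℕ, 1 ≤ n → x ∈ SWord S (List.ofFn fun k : Fin n => α k.val) '' K

/-- The critical set `C = ⋃_{i ≠ j} (K_i ∩ K_j)`. -/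
def CriticalSet {X : Type*} {m : ℕ} (S : Fin m → X → X) (K : Set X) : Set X :=
  ⋃ (i : Fin m) (j : Fin m) (_ : i ≠ j), (S i '' K) ∩ (S j '' K)

/-- The self-similar boundary
`∂K = {x ∈ K : S_w(x) ∈ C for some nonempty word w}`. -/
def SSBoundary {X : Type*} {m : ℕ} (S : Fin m → X → X) (K : Set X) : Set X :=
  {x | x ∈ K ∧ ∃ w : List (Fin m), w ≠ [] ∧ SWord S w x ∈ CriticalSet S K}

/-- `K` is a dendrite: compact, connected, locally connected (as a subspace), and
admitting no continuous injection of the unit circle. -/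
def IsDendrite {X : Type*} [TopologicalSpace X] (K : Set X) : Prop :=
  IsCompact K ∧ IsConnected K ∧ LocallyConnectedSpace K ∧
    ∀ f : (Metric.sphere (0 : ℂ) 1) → K, Continuous f → ¬ Function.Injective f

/-- The set of connected components of the set `A`. -/
def ComponentsIn {X : Type*} [TopologicalSpace X] (A : Set X) : Set (Set X) :=
  {C | ∃ y ∈ A, C = connectedComponentIn A y}

/-- The main tree of `K`: the intersection of all closed connected sets `A` with
`∂K ⊆ A ⊆ K`. -/
def MainTree {X : Type*} [TopologicalSpace X] {m : ℕ} (S : Fin m → X → X)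
    (K : Set X) : Set X :=
  ⋂₀ {A : Set X | IsClosed A ∧ IsConnected A ∧ SSBoundary S K ⊆ A ∧ A ⊆ K}

theorem SWord_append {X : Type*} {m : ℕ} (S : Fin m → X → X) (u v : List (Fin m)) (x : X) :
    SWord S (u ++ v) x = SWord S u (SWord S v x) := by
  induction u with
  | nil => rfl
  | cons i u ih => exact congrArg (S i) ih

theorem SWord_injective {X : Type*} {m : ℕ} {S : Fin m → X → X}
    (hinj : ∀ i, Function.Injective (S i)) (w : List (Fin m)) :
    Function.Injective (SWord S w) := by
  induction w with
  | nil => exact Function.injective_id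
  | cons i w ih => exact (hinj i).comp ih

theorem SWord_ofFn_succ {X : Type*} {m : ℕ} (S : Fin m → X → X) (ι : ℕ → Fin m) (n : ℕ)
    (x : X) :
    SWord S (List.ofFn fun k : Fin (n + 1) => ι k.val) x =
      SWord S (List.ofFn fun k : Fin n => ι k.val) (S (ι n) x) := by
  rw [List.ofFn_succ_last, SWord_append]
  simp [SWord]

/-- A point of `K` that some word maps into the self-similar boundary is a boundary point. -/
theorem mem_SSBoundary_of_SWord_mem {X : Type*} {m : ℕ} {S : Fin m → X → X} {K : Set X}
    {w : List (Fin m)} {x : X} (hx : x ∈ K) (h : SWord S w x ∈ SSBoundary S K) :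
    x ∈ SSBoundary S K := by
  obtain ⟨-, v, hv, hC⟩ := h
  exact ⟨hx, v ++ w, by simp [hv], by rwa [SWord_append]⟩

/-- **Proposition 3.6**: `ι` is an address of the boundary point `p` iff there is an
infinite walk in the index diagram starting from `p` whose labels are `ι`. -/
theorem address_iff_walk_in_index_diagram
    {X : Type*} [MetricSpace X] [CompleteSpace X] {m : ℕ}
    (S : Fin m → X → X) (r : Fin m → NNReal) (hr : ∀ i, r i < 1)
    (hlip : ∀ i, LipschitzWith (r i) (S i)) (hinj : ∀ i, Function.Injective (S i))
    (K : Set X) (hKne : K.Nonempty) (hKcp : IsCompact K) (hKeq : K = ⋃ i, S i '' K)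
    (p : X) (hp : p ∈ SSBoundary S K) (ι : ℕ → Fin m) :
    IsAddress S K p ι ↔
      ∃ q : ℕ → X, (∀ n, q n ∈ SSBoundary S K) ∧ q 0 = p ∧
        ∀ n : ℕ, S (ι n) (q (n + 1)) = q n := by
  constructor
  · intro h
    have h' : ∀ n : ℕ, ∃ y ∈ K, SWord S (List.ofFn fun k : Fin n => ι k.val) y = p := by
      rintro (_ | n)
      · exact ⟨p, hp.1, by simp [SWord]⟩
      · exact h (n + 1) (Nat.le_add_left 1 n)
    choose q hqK hq using h'
    refine ⟨q, fun n => mem_SSBoundary_of_SWord_mem (hqK n) ((hq n).symm ▸ hp), ?_, fun n => ?_⟩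
    · simpa [SWord] using hq 0
    · apply SWord_injective hinj (List.ofFn fun k : Fin n => ι k.val)
      rw [← SWord_ofFn_succ, hq, hq]
  · rintro ⟨q, hqB, hq0, hq⟩ n -
    refine ⟨q n, (hqB n).1, ?_⟩
    induction n with
    | zero => simpa [SWord] using hq0
    | succ n ih => rw [SWord_ofFn_succ, hq, ih]
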